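/- Let m, n ≥ 1, d = m + n, and let ψ : [1,∞) → (0,∞) be a decreasing function. Then for every ε ∈ (0, 1/2) there is a constant C > 0 (depending on ε, ψ, m, n) such that for all T > 10: |vol(E⁻_{T,ε,∞}) − (1+ε)^{−2} vol(E_{T,∞})| ≤ C and |vol(E⁺_{T,ε,∞}) − (1+ε)^{2} vol(E_{T,∞})| ≤ C; equivalently, vol(E^±_{T,ε,∞}) = (1+ε)^{±2} π^d ∫_1^T ψ(t) dt + O(1) as T varies. -/

import Mathlib

open MeasureTheory Filter Topology Matrix

noncomputable section

/-- `‖x‖_∞ = max_i |x_i|²`: the supremum of the squared absolute values of the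
coordinates (the normalized absolute value at a complex place). -/
def cnorm {k : Type*} [Fintype k] (x : k → ℂ) : ℝ := ⨆ i, Complex.normSq (x i)

/-- `E_{T,∞} = {(x,y) ∈ ℂ^m × ℂ^n : ‖x‖_∞^m ≤ ψ(‖y‖_∞^n), 1 ≤ ‖y‖_∞^n < T}`,
realized inside `ℂ^d` with `d`-index set `Fin m ⊕ Fin n`. -/
def EinfS (m n : ℕ) (ψ : ℝ → ℝ) (T : ℝ) : Set ((Fin m ⊕ Fin n) → ℂ) :=
  {z | cnorm (fun i : Fin m => z (Sum.inl i)) ^ m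
        ≤ ψ (cnorm (fun j : Fin n => z (Sum.inr j)) ^ n)
    ∧ 1 ≤ cnorm (fun j : Fin n => z (Sum.inr j)) ^ n
    ∧ cnorm (fun j : Fin n => z (Sum.inr j)) ^ n < T}

/-- `E⁻_{T,ε,∞}`. -/
def EminusS (m n : ℕ) (ψ : ℝ → ℝ) (ε T : ℝ) : Set ((Fin m ⊕ Fin n) → ℂ) :=
  {z | cnorm (fun i : Fin m => z (Sum.inl i)) ^ m
        ≤ (1 + ε)⁻¹ * ψ ((1 + ε) * cnorm (fun j : Fin n => z (Sum.inr j)) ^ n)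
    ∧ 3 / 2 ≤ cnorm (fun j : Fin n => z (Sum.inr j)) ^ n
    ∧ cnorm (fun j : Fin n => z (Sum.inr j)) ^ n < (1 + ε)⁻¹ * T}

/-- `E′_{T,ε,∞}`. -/
def EprimeS (m n : ℕ) (ψ : ℝ → ℝ) (ε T : ℝ) : Set ((Fin m ⊕ Fin n) → ℂ) :=
  {z | cnorm (fun i : Fin m => z (Sum.inl i)) ^ m
        ≤ (1 + ε) * ψ ((1 + ε)⁻¹ * cnorm (fun j : Fin n => z (Sum.inr j)) ^ n)
    ∧ 3 / 2 ≤ cnorm (fun j : Fin n => z (Sum.inr j)) ^ n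
    ∧ cnorm (fun j : Fin n => z (Sum.inr j)) ^ n ≤ (1 + ε) * T}

/-- `C₀ = {(x,y) : ‖x‖_∞^m ≤ 2ψ(1), 1/2 ≤ ‖y‖_∞^n ≤ 3/2}`. -/
def CzeroS (m n : ℕ) (ψ : ℝ → ℝ) : Set ((Fin m ⊕ Fin n) → ℂ) :=
  {z | cnorm (fun i : Fin m => z (Sum.inl i)) ^ m ≤ 2 * ψ 1
    ∧ 1 / 2 ≤ cnorm (fun j : Fin n => z (Sum.inr j)) ^ n
    ∧ cnorm (fun j : Fin n => z (Sum.inr j)) ^ n ≤ 3 / 2}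

/-- `E⁺_{T,ε,∞} = E′_{T,ε,∞} ∪ C₀`. -/
def EplusS (m n : ℕ) (ψ : ℝ → ℝ) (ε T : ℝ) : Set ((Fin m ⊕ Fin n) → ℂ) :=
  EprimeS m n ψ ε T ∪ CzeroS m n ψ

lemma cnorm_eq_norm_sq {k : Type*} [Fintype k] [Nonempty k] (x : k → ℂ) :
    cnorm x = ‖x‖ ^ 2 := by
  unfold cnorm
  apply le_antisymm
  · refine ciSup_le fun i => ?_
    rw [Complex.normSq_eq_norm_sq]
    gcongr
    exact norm_le_pi_norm x i
  · obtain ⟨i, hi⟩ := Finite.exists_max fun i => ‖x i‖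
    refine (pow_le_pow_left₀ (norm_nonneg x) ((pi_norm_le_iff_of_nonempty x).2 hi) 2).trans ?_
    rw [← Complex.normSq_eq_norm_sq]
    exact le_ciSup (f := fun i => Complex.normSq (x i)) (Set.finite_range _).bddAbove i

lemma measurable_cnorm {k : Type*} [Fintype k] : Measurable (cnorm : (k → ℂ) → ℝ) :=
  Measurable.iSup fun i => Complex.continuous_normSq.measurable.comp (measurable_pi_apply i)

lemma volume_cnorm_pow_le (m : ℕ) (hm : 1 ≤ m) (r : ℝ) :
    volume {x : Fin m → ℂ | cnorm x ^ m ≤ r} = ENNReal.ofReal Real.pi ^ m * ENNReal.ofReal r := by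
  have : Nonempty (Fin m) := ⟨⟨0, hm⟩⟩
  have hm0 : 2 * m ≠ 0 := by omega
  simp only [cnorm_eq_norm_sq, ← pow_mul]
  rcases lt_or_ge r 0 with hr | hr
  · have : {x : Fin m → ℂ | ‖x‖ ^ (2 * m) ≤ r} = ∅ := by
      ext x
      simpa using hr.trans_le (by positivity)
    rw [this, ENNReal.ofReal_of_nonpos hr.le]
    simp
  · set ρ : ℝ := r ^ (((2 * m : ℕ) : ℝ)⁻¹) with hρ
    have hρ0 : 0 ≤ ρ := Real.rpow_nonneg hr _
    have hρr : ρ ^ (2 * m) = r := Real.rpow_inv_natCast_pow hr hm0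
    have : {x : Fin m → ℂ | ‖x‖ ^ (2 * m) ≤ r} = Metric.closedBall 0 ρ := by
      ext x
      rw [Set.mem_ofPred_eq, mem_closedBall_zero_iff, ← hρr,
        pow_le_pow_iff_left₀ (norm_nonneg x) hρ0 hm0]
    rw [this, volume_pi, Measure.pi_closedBall _ _ hρ0]
    have hpi : (NNReal.pi : ENNReal) = ENNReal.ofReal Real.pi :=
      (ENNReal.ofReal_coe_nnreal (p := NNReal.pi)).symm
    simp only [Complex.volume_closedBall, Finset.prod_const, Finset.card_univ, Fintype.card_fin]
    rw [hpi, mul_pow, ← pow_mul, mul_comm, ← hρr, ENNReal.ofReal_pow hρ0]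

lemma map_cnorm_pow (n : ℕ) (hn : 1 ≤ n) :
    Measure.map (fun y : Fin n → ℂ => cnorm y ^ n) volume
      = ENNReal.ofReal Real.pi ^ n • volume.restrict (Set.Ici (0 : ℝ)) := by
  have hmeas : Measurable (fun y : Fin n → ℂ => cnorm y ^ n) := measurable_cnorm.pow_const n
  have hfin : ENNReal.ofReal Real.pi ^ n ≠ ⊤ := ENNReal.pow_ne_top ENNReal.ofReal_ne_top
  have hleft (t : ℝ) : Measure.map (fun y : Fin n → ℂ => cnorm y ^ n) volume (Set.Iic t)
      = ENNReal.ofReal Real.pi ^ n * ENNReal.ofReal t := by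
    rw [Measure.map_apply hmeas measurableSet_Iic]
    exact volume_cnorm_pow_le n hn t
  have hright (t : ℝ) : (ENNReal.ofReal Real.pi ^ n • volume.restrict (Set.Ici (0 : ℝ))) (Set.Iic t)
      = ENNReal.ofReal Real.pi ^ n * ENNReal.ofReal t := by
    rw [Measure.smul_apply, Measure.restrict_apply measurableSet_Iic, Set.inter_comm,
      Set.Ici_inter_Iic, Real.volume_Icc, sub_zero, smul_eq_mul]
  have hne (t : ℝ) : ENNReal.ofReal Real.pi ^ n * ENNReal.ofReal t ≠ ⊤ :=
    ENNReal.mul_ne_top hfin ENNReal.ofReal_ne_top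
  symm
  refine Measure.ext_of_Ioc' _ _ (fun a b _ => ?_) fun a b hab => ?_
  · refine ne_top_of_le_ne_top (hne b) ?_
    rw [← hright]
    exact measure_mono Set.Ioc_subset_Iic_self
  rw [← Set.Iic_sdiff_Iic,
    measure_sdiff (Set.Iic_subset_Iic.2 hab.le) measurableSet_Iic.nullMeasurableSet
      (by rw [hright]; exact hne a),
    measure_sdiff (Set.Iic_subset_Iic.2 hab.le) measurableSet_Iic.nullMeasurableSet
      (by rw [hleft]; exact hne a)]
  simp only [hleft, hright]

/-- The points `(x, y) ∈ ℂ^m × ℂ^n` with `‖x‖_∞^m ≤ g (‖y‖_∞^n)` and `‖y‖_∞^n ∈ J`. -/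
def cnormSubgraph (m n : ℕ) (g : ℝ → ℝ) (J : Set ℝ) : Set ((Fin m ⊕ Fin n) → ℂ) :=
  {z | cnorm (fun i : Fin m => z (Sum.inl i)) ^ m
        ≤ g (cnorm (fun j : Fin n => z (Sum.inr j)) ^ n)
    ∧ cnorm (fun j : Fin n => z (Sum.inr j)) ^ n ∈ J}

lemma volume_cnormSubgraph (m n : ℕ) (hm : 1 ≤ m) (hn : 1 ≤ n) {g : ℝ → ℝ} (hg : Measurable g)
    {J : Set ℝ} (hJ : MeasurableSet J) (hJ0 : J ⊆ Set.Ici 0) :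
    volume (cnormSubgraph m n g J)
      = ENNReal.ofReal Real.pi ^ (m + n) * ∫⁻ t in J, ENNReal.ofReal (g t) := by
  set S : Set ((Fin m → ℂ) × (Fin n → ℂ)) :=
    {p | cnorm p.1 ^ m ≤ g (cnorm p.2 ^ n) ∧ cnorm p.2 ^ n ∈ J} with hS
  have hx : Measurable fun p : (Fin m → ℂ) × (Fin n → ℂ) => cnorm p.1 ^ m :=
    (measurable_cnorm.comp measurable_fst).pow_const m
  have hy : Measurable fun p : (Fin m → ℂ) × (Fin n → ℂ) => cnorm p.2 ^ n :=
    (measurable_cnorm.comp measurable_snd).pow_const n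
  have hSm : MeasurableSet S := (measurableSet_le hx (hg.comp hy)).inter (hy hJ)
  have hpre : cnormSubgraph m n g J
      = MeasurableEquiv.sumPiEquivProdPi (fun _ : Fin m ⊕ Fin n => ℂ) ⁻¹' S := rfl
  have hF : Measurable (J.indicator fun t => ENNReal.ofReal Real.pi ^ m * ENNReal.ofReal (g t)) :=
    (hg.ennreal_ofReal.const_mul _).indicator hJ
  rw [hpre, (volume_measurePreserving_sumPiEquivProdPi
    (fun _ : Fin m ⊕ Fin n => ℂ)).measure_preimage hSm.nullMeasurableSet,
    Measure.volume_eq_prod, Measure.prod_apply_symm hSm]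
  have hslice (y : Fin n → ℂ) : volume ((fun x : Fin m → ℂ => (x, y)) ⁻¹' S)
      = J.indicator (fun t => ENNReal.ofReal Real.pi ^ m * ENNReal.ofReal (g t))
          (cnorm y ^ n) := by
    by_cases h : cnorm y ^ n ∈ J
    · rw [Set.indicator_of_mem h, ← volume_cnorm_pow_le m hm]
      simp [hS, h]
    · rw [Set.indicator_of_notMem h]
      simp [hS, h]
  simp only [hslice]
  rw [← lintegral_map hF (measurable_cnorm.pow_const n), map_cnorm_pow n hn,
    lintegral_smul_measure, lintegral_indicator hJ, Measure.restrict_restrict hJ,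
    Set.inter_eq_left.2 hJ0, lintegral_const_mul _ hg.ennreal_ofReal, smul_eq_mul, pow_add]
  ring

lemma volume_cnormSubgraph_eq_integral (m n : ℕ) (hm : 1 ≤ m) (hn : 1 ≤ n) {g : ℝ → ℝ}
    (hg : Antitone g) (hg0 : ∀ t, 0 ≤ g t) {a b : ℝ} (ha : 0 ≤ a) (hab : a ≤ b)
    {J : Set ℝ} (hJ : MeasurableSet J)
    (hJa : J ⊆ Set.Ici a) (hJab : J =ᵐ[volume] Set.Ioc a b) :
    volume (cnormSubgraph m n g J)
      = ENNReal.ofReal (Real.pi ^ (m + n) * ∫ t in a..b, g t) := by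
  rw [volume_cnormSubgraph m n hm hn hg.measurable hJ (hJa.trans (Set.Ici_subset_Ici.2 ha)),
    setLIntegral_congr hJab, intervalIntegral.integral_of_le hab,
    ENNReal.ofReal_mul (by positivity), ENNReal.ofReal_pow Real.pi_pos.le,
    ofReal_integral_eq_lintegral_ofReal 
      ((intervalIntegrable_iff_integrableOn_Ioc_of_le hab).1 hg.intervalIntegrable)
      (ae_of_all _ hg0)]

lemma toReal_volume_cnormSubgraph (m n : ℕ) (hm : 1 ≤ m) (hn : 1 ≤ n) {g : ℝ → ℝ}
    (hg : Antitone g) (hg0 : ∀ t, 0 ≤ g t) {a b : ℝ} (ha : 0 ≤ a) (hab : a ≤ b)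
    {J : Set ℝ} (hJ : MeasurableSet J)
    (hJa : J ⊆ Set.Ici a) (hJab : J =ᵐ[volume] Set.Ioc a b) :
    (volume (cnormSubgraph m n g J)).toReal = Real.pi ^ (m + n) * ∫ t in a..b, g t := by
  rw [volume_cnormSubgraph_eq_integral m n hm hn hg hg0 ha hab hJ hJa hJab, ENNReal.toReal_ofReal]
  exact mul_nonneg (by positivity) (intervalIntegral.integral_nonneg hab fun t _ => hg0 t)

lemma cnormSubgraph_congr {m n : ℕ} {g h : ℝ → ℝ} {J : Set ℝ} (hgh : Set.EqOn g h J) :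
    cnormSubgraph m n g J = cnormSubgraph m n h J := by
  ext z
  refine and_congr_left fun hz => ?_
  rw [hgh hz]

/-- Equation (3.18) of the paper: for every `ε ∈ (0, 1/2)` there is a constant `C > 0`
such that for all `T > 10`,
`vol(E^±_{T,ε,∞}) = (1+ε)^{±2} vol(E_{T,∞}) + O(1) = (1+ε)^{±2} π^d ∫_1^T ψ(t) dt + O(1)`. -/
theorem volume_E_pm (m n : ℕ) (hm : 1 ≤ m) (hn : 1 ≤ n)
    (ψ : ℝ → ℝ) (hψpos : ∀ t, 1 ≤ t → 0 < ψ t) (hψdec : AntitoneOn ψ (Set.Ici 1)) :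
    ∀ ε : ℝ, 0 < ε → ε < 1 / 2 →
      ∃ C > (0 : ℝ), ∀ T : ℝ, 10 < T →
        |(volume (EminusS m n ψ ε T)).toReal
            - ((1 + ε) ^ 2)⁻¹ * (volume (EinfS m n ψ T)).toReal| ≤ C ∧
        |(volume (EplusS m n ψ ε T)).toReal
            - (1 + ε) ^ 2 * (volume (EinfS m n ψ T)).toReal| ≤ C ∧
        |(volume (EminusS m n ψ ε T)).toReal
            - ((1 + ε) ^ 2)⁻¹ * (Real.pi ^ (m + n) * ∫ t in (1:ℝ)..T, ψ t)| ≤ C ∧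
        |(volume (EplusS m n ψ ε T)).toReal
            - (1 + ε) ^ 2 * (Real.pi ^ (m + n) * ∫ t in (1:ℝ)..T, ψ t)| ≤ C := by
  intro ε hε hε2
  set φ : ℝ → ℝ := fun t => ψ (max 1 t) with hφ
  have hφψ {t : ℝ} (ht : 1 ≤ t) : φ t = ψ t := by simp only [hφ, max_eq_right ht]
  have hφanti : Antitone φ := fun s t hst =>
    hψdec (le_max_left 1 s) (le_max_left 1 t) (max_le_max le_rfl hst)
  have hφ0 (t : ℝ) : 0 ≤ φ t := (hψpos _ (le_max_left 1 t)).le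
  have hφint (a b : ℝ) : IntervalIntegrable φ volume a b := hφanti.intervalIntegrable
  set c : ℝ := 1 + ε with hc
  have hc0 : 0 < c := by linarith
  have hc1 : 1 < c := by linarith
  have hc2 : c < 3 / 2 := by linarith
  have hci : c⁻¹ < 1 := inv_lt_one_of_one_lt₀ hc1
  have hcinv : 2 / 3 < c⁻¹ := by rw [lt_inv_comm₀ (by norm_num) hc0]; norm_num; exact hc2
  set P : ℝ := Real.pi ^ (m + n) with hP
  have hE (T : ℝ) (hT : 10 < T) :
      (volume (EinfS m n ψ T)).toReal = P * ∫ t in (1 : ℝ)..T, φ t := by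
    have : EinfS m n ψ T = cnormSubgraph m n φ (Set.Ico 1 T) :=
      cnormSubgraph_congr (m := m) (n := n) (g := ψ) (h := φ) (J := Set.Ico 1 T)
        fun t ht => (hφψ ht.1).symm
    rw [this, toReal_volume_cnormSubgraph m n hm hn hφanti hφ0 zero_le_one (by linarith)
      measurableSet_Ico (fun t ht => ht.1) Ico_ae_eq_Ioc]
  have hψint (T : ℝ) (hT : 10 < T) : ∫ t in (1 : ℝ)..T, ψ t = ∫ t in (1 : ℝ)..T, φ t := by
    refine intervalIntegral.integral_congr fun t ht => ?_
    rw [Set.uIcc_of_le (by linarith)] at ht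
    exact (hφψ ht.1).symm
  have hminus (T : ℝ) (hT : 10 < T) : (volume (EminusS m n ψ ε T)).toReal
      = (c ^ 2)⁻¹ * (P * ∫ t in (c * (3 / 2))..T, φ t) := by
    have : EminusS m n ψ ε T
        = cnormSubgraph m n (fun t => c⁻¹ * φ (c * t)) (Set.Ico (3 / 2) (c⁻¹ * T)) :=
      cnormSubgraph_congr (m := m) (n := n) (g := fun t => c⁻¹ * ψ (c * t))
        (h := fun t => c⁻¹ * φ (c * t)) (J := Set.Ico (3 / 2) (c⁻¹ * T)) fun t ht => by
        have h1 : 1 ≤ c * t := by nlinarith [ht.1]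
        simp only [hφψ h1]
    rw [this, toReal_volume_cnormSubgraph m n hm hn
      (fun s t hst => by
        have := hφanti (mul_le_mul_of_nonneg_left hst hc0.le)
        exact mul_le_mul_of_nonneg_left this (by positivity))
      (fun t => mul_nonneg (by positivity) (hφ0 _)) (by norm_num) (by nlinarith)
      measurableSet_Ico (fun t ht => ht.1) Ico_ae_eq_Ioc,
      intervalIntegral.integral_const_mul, intervalIntegral.integral_comp_mul_left _ hc0.ne',
      mul_inv_cancel_left₀ hc0.ne', smul_eq_mul, ← hP]
    ring_nf
  have hprime (T : ℝ) (hT : 10 < T) : volume (EprimeS m n ψ ε T)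
      = ENNReal.ofReal (c ^ 2 * (P * ∫ t in (c⁻¹ * (3 / 2))..T, φ t)) := by
    have : EprimeS m n ψ ε T
        = cnormSubgraph m n (fun t => c * φ (c⁻¹ * t)) (Set.Icc (3 / 2) (c * T)) :=
      cnormSubgraph_congr (m := m) (n := n) (g := fun t => c * ψ (c⁻¹ * t))
        (h := fun t => c * φ (c⁻¹ * t)) (J := Set.Icc (3 / 2) (c * T)) fun t ht => by
        have h1 : 1 ≤ c⁻¹ * t := by nlinarith [ht.1]
        simp only [hφψ h1]
    have hanti : Antitone fun t => c * φ (c⁻¹ * t) := fun s t hst =>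
      mul_le_mul_of_nonneg_left
        (hφanti (mul_le_mul_of_nonneg_left hst (inv_nonneg.2 hc0.le))) hc0.le
    rw [this, volume_cnormSubgraph_eq_integral m n hm hn hanti
      (fun t => mul_nonneg hc0.le (hφ0 _)) (by norm_num) (by nlinarith)
      measurableSet_Icc (fun t ht => ht.1) Ioc_ae_eq_Icc.symm,
      intervalIntegral.integral_const_mul,
      intervalIntegral.integral_comp_mul_left _ (inv_ne_zero hc0.ne'),
      inv_mul_cancel_left₀ hc0.ne', smul_eq_mul, inv_inv, ← hP]
    ring_nf
  have hprimefin (T : ℝ) (hT : 10 < T) : volume (EprimeS m n ψ ε T) ≠ ⊤ := by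
    rw [hprime T hT]
    exact ENNReal.ofReal_ne_top
  have hprimereal (T : ℝ) (hT : 10 < T) : (volume (EprimeS m n ψ ε T)).toReal
      = c ^ 2 * (P * ∫ t in (c⁻¹ * (3 / 2))..T, φ t) := by
    have := intervalIntegral.integral_nonneg (μ := volume) (f := φ) (a := c⁻¹ * (3 / 2)) (b := T)
      (by linarith) fun t _ => hφ0 t
    rw [hprime T hT, ENNReal.toReal_ofReal (by positivity)]
  have hzerofin : volume (CzeroS m n ψ) ≠ ⊤ := by
    have : CzeroS m n ψ = cnormSubgraph m n (fun _ => 2 * ψ 1) (Set.Icc (1 / 2) (3 / 2)) := rfl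
    rw [this, volume_cnormSubgraph_eq_integral m n hm hn antitone_const
      (fun _ => by linarith [hψpos 1 le_rfl]) (a := 1 / 2) (b := 3 / 2) (by norm_num) (by norm_num)
      measurableSet_Icc (fun t ht => ht.1) Ioc_ae_eq_Icc.symm]
    exact ENNReal.ofReal_ne_top
  set A : ℝ := ∫ t in (1 : ℝ)..(c * (3 / 2)), φ t with hA
  set B : ℝ := ∫ t in (1 : ℝ)..(c⁻¹ * (3 / 2)), φ t with hB
  set V : ℝ := (volume (CzeroS m n ψ)).toReal with hV
  have hV0 : 0 ≤ V := ENNReal.toReal_nonneg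
  refine ⟨|(c ^ 2)⁻¹ * (P * A)| + |c ^ 2 * (P * B)| + V + 1, by positivity, fun T hT => ?_⟩
  have hAT := intervalIntegral.integral_add_adjacent_intervals
    (hφint 1 (c * (3 / 2))) (hφint (c * (3 / 2)) T)
  have hBT := intervalIntegral.integral_add_adjacent_intervals
    (hφint 1 (c⁻¹ * (3 / 2))) (hφint (c⁻¹ * (3 / 2)) T)
  have hm' : |(volume (EminusS m n ψ ε T)).toReal
      - (c ^ 2)⁻¹ * (P * ∫ t in (1 : ℝ)..T, φ t)|
      ≤ |(c ^ 2)⁻¹ * (P * A)| + |c ^ 2 * (P * B)| + V + 1 := by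
    rw [hminus T hT, ← hAT, ← hA, ← mul_sub, ← mul_sub, sub_add_cancel_right, mul_neg, mul_neg,
      abs_neg]
    linarith [abs_nonneg (c ^ 2 * (P * B))]
  have hp' : |(volume (EplusS m n ψ ε T)).toReal
      - c ^ 2 * (P * ∫ t in (1 : ℝ)..T, φ t)|
      ≤ |(c ^ 2)⁻¹ * (P * A)| + |c ^ 2 * (P * B)| + V + 1 := by
    have hlow : (volume (EprimeS m n ψ ε T)).toReal ≤ (volume (EplusS m n ψ ε T)).toReal :=
      ENNReal.toReal_mono (measure_union_ne_top (hprimefin T hT) hzerofin)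
        (measure_mono Set.subset_union_left)
    have hupp : (volume (EplusS m n ψ ε T)).toReal
        ≤ (volume (EprimeS m n ψ ε T)).toReal + V := by
      rw [hV, ← ENNReal.toReal_add (hprimefin T hT) hzerofin]
      exact ENNReal.toReal_mono (ENNReal.add_ne_top.2 ⟨hprimefin T hT, hzerofin⟩)
        (measure_union_le _ _)
    rw [hprimereal T hT] at hlow hupp
    rw [← hBT, ← hB, mul_add, mul_add, abs_le]
    constructor <;>
      linarith [le_abs_self (c ^ 2 * (P * B)), neg_abs_le (c ^ 2 * (P * B)),
        abs_nonneg ((c ^ 2)⁻¹ * (P * A))]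
  rw [hE T hT, hψint T hT]
  exact ⟨hm', hp', hm', hp'⟩
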